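/- Let λ, ℓ : ℕ, let G : BitVec λ → BitVec (3·λ) be injective, and let s : Fin ℓ → BitVec (3·λ) be such that for every i : Fin ℓ and all r, r' : BitVec λ we have s i ≠ G r ^^^ G r'. Then the commitment map from (Fin ℓ → Bool) × (Fin ℓ → BitVec λ) to (Fin ℓ → BitVec (3·λ)) sending (m, r) to the function i ↦ G (r i) ^^^ (if m i then s i else 0) is injective. -/

import Mathlib

theorem naor_commitment_injective (l L : ℕ) (G : BitVec l → BitVec (3 * l))
    (hG : Function.Injective G) (s : Fin L → BitVec (3 * l))
    (hs : ∀ (i : Fin L) (r r' : BitVec l), s i ≠ G r ^^^ G r') :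
    Function.Injective (fun p : (Fin L → Bool) × (Fin L → BitVec l) =>
      fun i : Fin L => G (p.2 i) ^^^ (if p.1 i then s i else 0)) := by
  rintro ⟨m, r⟩ ⟨m', r'⟩ h
  have key (i : Fin L) : m i = m' i ∧ r i = r' i := by
    have hi := congrFun h i
    cases hm : m i <;> cases hm' : m' i <;> simp [hm, hm'] at hi
    · exact ⟨rfl, hG hi⟩
    · refine absurd ?_ (hs i (r' i) (r i))
      rw [hi, ← BitVec.xor_assoc, BitVec.xor_self, BitVec.zero_xor]
    · refine absurd ?_ (hs i (r i) (r' i))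
      rw [← hi, ← BitVec.xor_assoc, BitVec.xor_self, BitVec.zero_xor]
    · exact ⟨rfl, hG hi⟩
  exact Prod.ext (funext fun i => (key i).1) (funext fun i => (key i).2)
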